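/- arXiv:0803.0477 — 2 statements merged into one kernel-verified Lean document; each statement's English description precedes it below -/
import Mathlib

section
/- There exists an absolute constant C > 0 such that for all real x ≥ 1, (1/x) · Σ_{k ≤ x, k odd} c_k/2^k ≤ C/log log log x. In particular, the ratios c_k/2^k over odd k tend to 0 in arithmetic average. -/
open Filter

/-- `binDigitSum n` is the sum of the binary digits of `n`. -/
def binDigitSum (n : ℕ) : ℕ := (Nat.digits 2 n).sum

/-- `ak k` is the smallest positive multiple of `k` whose binary digit sum equals
`k` (the minimal binary Niven number with digit sum `k`). -/
noncomputable def ak (k : ℕ) : ℕ :=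
  sInf {N : ℕ | 0 < N ∧ k ∣ N ∧ binDigitSum N = k}

/-- `plog x = max (ln x) 1`, the variant of the logarithm used in the paper. -/
noncomputable def plog (x : ℝ) : ℝ := max (Real.log x) 1

lemma binDigitSum_two_mul (n : ℕ) : binDigitSum (2 * n) = binDigitSum n := by
  rcases Nat.eq_zero_or_pos n with rfl | hn
  · rfl
  · unfold binDigitSum
    rw [Nat.digits_def' (by norm_num) (by omega)]
    simp

lemma binDigitSum_two_mul_add_one (n : ℕ) :
    binDigitSum (2 * n + 1) = binDigitSum n + 1 := by
  unfold binDigitSum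
  rw [Nat.digits_def' (by norm_num) (by omega),
    show (2 * n + 1) % 2 = 1 by omega, show (2 * n + 1) / 2 = n by omega, List.sum_cons, add_comm]

lemma binDigitSum_le_of_lt_two_pow {n L : ℕ} (h : n < 2 ^ L) : binDigitSum n ≤ L := by
  induction L generalizing n with
  | zero =>
    obtain rfl : n = 0 := by simpa using h
    simp [binDigitSum]
  | succ L ih =>
    rw [pow_succ] at h
    rcases Nat.even_or_odd' n with ⟨a, rfl | rfl⟩
    · rw [binDigitSum_two_mul]
      exact (ih (by omega)).trans (by omega)
    · rw [binDigitSum_two_mul_add_one]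
      exact Nat.succ_le_succ (ih (by omega))

lemma binDigitSum_lt_of_succ_lt_two_pow {n L : ℕ} (h : n + 1 < 2 ^ L) : binDigitSum n < L := by
  induction L generalizing n with
  | zero => simp at h
  | succ L ih =>
    rw [pow_succ] at h
    rcases Nat.even_or_odd' n with ⟨a, rfl | rfl⟩
    · rw [binDigitSum_two_mul]
      exact Nat.lt_succ_of_le (binDigitSum_le_of_lt_two_pow (by omega))
    · rw [binDigitSum_two_mul_add_one]
      exact Nat.succ_lt_succ (ih (by omega))

lemma binDigitSum_add_two_pow {a m : ℕ} (h : a < 2 ^ m) :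
    binDigitSum (a + 2 ^ m) = binDigitSum a + 1 := by
  induction m generalizing a with
  | zero =>
    obtain rfl : a = 0 := by simpa using h
    simp [binDigitSum]
  | succ m ih =>
    rw [pow_succ] at h
    rcases Nat.even_or_odd' a with ⟨b, rfl | rfl⟩
    · rw [show 2 * b + 2 ^ (m + 1) = 2 * (b + 2 ^ m) by ring, binDigitSum_two_mul,
        binDigitSum_two_mul, ih (by omega)]
    · rw [show 2 * b + 1 + 2 ^ (m + 1) = 2 * (b + 2 ^ m) + 1 by ring,
        binDigitSum_two_mul_add_one, binDigitSum_two_mul_add_one, ih (by omega)]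

lemma binDigitSum_sum_two_pow (S : Finset ℕ) : binDigitSum (∑ i ∈ S, 2 ^ i) = S.card := by
  induction S using Finset.induction_on_max with
  | empty => simp [binDigitSum]
  | insert m S hS ih =>
    have hm : m ∉ S := fun h => lt_irrefl _ (hS m h)
    rw [Finset.sum_insert hm, Finset.card_insert_of_notMem hm, add_comm,
      binDigitSum_add_two_pow (Nat.geomSum_lt le_rfl hS), ih]

/-- Few integers below `2 ^ L` have at most `w` binary digits equal to `0`. -/
lemma card_filter_le_binDigitSum_add (L w : ℕ) :
    ((Finset.range (2 ^ L)).filter (fun R => L ≤ binDigitSum R + w)).card ≤ (L + 1) ^ w := by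
  induction L generalizing w with
  | zero => simp
  | succ L ih =>
    have hsub : (Finset.range (2 ^ (L + 1))).filter (fun R => L + 1 ≤ binDigitSum R + w) ⊆
        (((Finset.range (2 ^ L)).filter (fun R => L ≤ binDigitSum R + w)).image
            (fun R => 2 * R + 1)) ∪
          (((Finset.range (2 ^ L)).filter (fun R => L + 1 ≤ binDigitSum R + w)).image
            (fun R => 2 * R)) := by
      intro R hR
      rw [Finset.mem_filter, Finset.mem_range, pow_succ] at hR
      rw [Finset.mem_union, Finset.mem_image, Finset.mem_image]
      rcases Nat.even_or_odd' R with ⟨b, rfl | rfl⟩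
      · rw [binDigitSum_two_mul] at hR
        exact Or.inr ⟨b, by rw [Finset.mem_filter, Finset.mem_range]; omega, rfl⟩
      · rw [binDigitSum_two_mul_add_one] at hR
        exact Or.inl ⟨b, by rw [Finset.mem_filter, Finset.mem_range]; omega, rfl⟩
    refine (Finset.card_le_card hsub).trans ((Finset.card_union_le _ _).trans ?_)
    refine (add_le_add Finset.card_image_le Finset.card_image_le).trans ?_
    cases w with
    | zero =>
      have h0 : (Finset.range (2 ^ L)).filter (fun R => L + 1 ≤ binDigitSum R + 0) = ∅ := by
        refine Finset.filter_eq_empty_iff.2 fun R hR => ?_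
        have := binDigitSum_le_of_lt_two_pow (Finset.mem_range.1 hR)
        omega
      rw [h0]
      simpa using ih 0
    | succ w =>
      have h1 : (Finset.range (2 ^ L)).filter (fun R => L + 1 ≤ binDigitSum R + (w + 1)) =
          (Finset.range (2 ^ L)).filter (fun R => L ≤ binDigitSum R + w) :=
        Finset.filter_congr fun R _ => by omega
      rw [h1]
      refine (add_le_add (ih (w + 1)) (ih w)).trans ?_
      have h2 : (L + 1) ^ w ≤ (L + 1 + 1) ^ w := Nat.pow_le_pow_left (by omega) w
      calc (L + 1) ^ (w + 1) + (L + 1) ^ w = (L + 1) ^ w * (L + 1 + 1) := by ring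
        _ ≤ (L + 1 + 1) ^ w * (L + 1 + 1) := Nat.mul_le_mul_right _ h2
        _ = (L + 1 + 1) ^ (w + 1) := by ring

/-- The largest number of terms in a representation of `n` as a sum of powers of two in which
every power is used at most twice. -/
def maxTerms : ℕ → ℕ
  | 0 => 0
  | n + 1 => 1 + n % 2 + maxTerms (n / 2)

lemma maxTerms_two_mul_add_one (n : ℕ) : maxTerms (2 * n + 1) = maxTerms n + 1 := by
  rw [maxTerms, show 2 * n % 2 = 0 by omega, show 2 * n / 2 = n by omega]
  omega

lemma maxTerms_two_mul_add_two (n : ℕ) : maxTerms (2 * n + 2) = maxTerms n + 2 := by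
  rw [maxTerms, show (2 * n + 1) % 2 = 1 by omega, show (2 * n + 1) / 2 = n by omega]
  omega

lemma binDigitSum_succ_le (n : ℕ) : binDigitSum (n + 1) ≤ binDigitSum n + 1 := by
  induction n using Nat.strong_induction_on with
  | _ n ih =>
    rcases Nat.even_or_odd' n with ⟨a, rfl | rfl⟩
    · rw [binDigitSum_two_mul_add_one, binDigitSum_two_mul]
    · rw [show 2 * a + 1 + 1 = 2 * (a + 1) by ring, binDigitSum_two_mul,
        binDigitSum_two_mul_add_one]
      exact (ih a (by omega)).trans (by omega)

lemma binDigitSum_le_maxTerms (n : ℕ) :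
    binDigitSum n ≤ maxTerms n ∧ binDigitSum n + 1 ≤ maxTerms (n + 1) := by
  induction n using Nat.strong_induction_on with
  | _ n ih =>
    rcases Nat.even_or_odd' n with ⟨a, rfl | rfl⟩
    · rcases Nat.eq_zero_or_pos a with rfl | ha
      · simp [binDigitSum, maxTerms]
      · obtain ⟨b, rfl⟩ : ∃ b, a = b + 1 := ⟨a - 1, by omega⟩
        have h1 := ih (b + 1) (by omega)
        have h2 := ih b (by omega)
        have h3 := binDigitSum_succ_le b
        rw [maxTerms_two_mul_add_one, binDigitSum_two_mul, show 2 * (b + 1) = 2 * b + 2 by ring,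
          maxTerms_two_mul_add_two]
        omega
    · have h := ih a (by omega)
      rw [show 2 * a + 1 + 1 = 2 * a + 2 by ring, maxTerms_two_mul_add_two,
        maxTerms_two_mul_add_one, binDigitSum_two_mul_add_one]
      omega

lemma le_maxTerms {n t : ℕ} (h : 2 ^ t ≤ n + 1) : t ≤ maxTerms n := by
  induction n using Nat.strong_induction_on generalizing t with
  | _ n ih =>
    rcases t with _ | t
    · omega
    · rw [pow_succ] at h
      have ht := Nat.one_le_two_pow (n := t)
      rcases Nat.even_or_odd' (n - 1) with ⟨a, ha | ha⟩
      · obtain rfl : n = 2 * a + 1 := by omega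
        have := ih a (by omega) (t := t) (by omega)
        rw [maxTerms_two_mul_add_one]; omega
      · obtain rfl : n = 2 * a + 2 := by omega
        have := ih a (by omega) (t := t) (by omega)
        rw [maxTerms_two_mul_add_two]; omega

lemma sum_two_pow_image_succ (U : Finset ℕ) :
    ∑ i ∈ U.image Nat.succ, 2 ^ i = 2 * ∑ i ∈ U, 2 ^ i := by
  rw [Finset.sum_image fun a _ b _ h => Nat.succ_injective h, Finset.mul_sum]
  exact Finset.sum_congr rfl fun i _ => by rw [Nat.succ_eq_add_one, pow_succ, mul_comm]

lemma exists_card_sum_two_pow_two_mul (e : ℕ) (he : e ≤ 1) (U : Finset ℕ) :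
    ∃ U' : Finset ℕ, U'.card = U.card + e ∧ ∑ i ∈ U', 2 ^ i = 2 * ∑ i ∈ U, 2 ^ i + e := by
  have hcard : (U.image Nat.succ).card = U.card :=
    Finset.card_image_of_injective U Nat.succ_injective
  rcases Nat.eq_zero_or_pos e with rfl | h
  · exact ⟨U.image Nat.succ, hcard, sum_two_pow_image_succ U⟩
  · obtain rfl : e = 1 := by omega
    have h0 : 0 ∉ U.image Nat.succ := by simp
    refine ⟨insert 0 (U.image Nat.succ), ?_, ?_⟩
    · rw [Finset.card_insert_of_notMem h0, hcard]
    · rw [Finset.sum_insert h0, sum_two_pow_image_succ, pow_zero, add_comm]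

/-- Every number of terms between `binDigitSum n` and `maxTerms n` occurs among the
representations of `n` as a sum of powers of two with every power used at most twice. -/
lemma exists_sum_two_pow_add_sum_two_pow {n t : ℕ} (h1 : binDigitSum n ≤ t)
    (h2 : t ≤ maxTerms n) :
    ∃ U V : Finset ℕ, U.card + V.card = t ∧ ∑ i ∈ U, 2 ^ i + ∑ i ∈ V, 2 ^ i = n := by
  induction n using Nat.strong_induction_on generalizing t with
  | _ n ih =>
    rcases Nat.eq_zero_or_pos n with rfl | hn
    · obtain rfl : t = 0 := by simpa [maxTerms] using h2
      exact ⟨∅, ∅, by simp, by simp⟩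
    suffices ∃ a s e f : ℕ, e ≤ 1 ∧ f ≤ 1 ∧ a < n ∧ n = 2 * a + e + f ∧ t = s + e + f ∧
        binDigitSum a ≤ s ∧ s ≤ maxTerms a by
      obtain ⟨a, s, e, f, he, hf, ha, rfl, rfl, hs1, hs2⟩ := this
      obtain ⟨U, V, hc, hs⟩ := ih a ha hs1 hs2
      obtain ⟨U', hU1, hU2⟩ := exists_card_sum_two_pow_two_mul e he U
      obtain ⟨V', hV1, hV2⟩ := exists_card_sum_two_pow_two_mul f hf V
      exact ⟨U', V', by omega, by omega⟩
    rcases Nat.even_or_odd' (n - 1) with ⟨a, ha | ha⟩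
    · obtain rfl : n = 2 * a + 1 := by omega
      rw [binDigitSum_two_mul_add_one] at h1
      rw [maxTerms_two_mul_add_one] at h2
      exact ⟨a, t - 1, 1, 0, by omega, by omega, by omega, by omega, by omega, by omega, by omega⟩
    · obtain rfl : n = 2 * a + 2 := by omega
      rw [maxTerms_two_mul_add_two] at h2
      rw [show 2 * a + 2 = 2 * (a + 1) by ring, binDigitSum_two_mul] at h1
      rcases le_or_gt t (maxTerms (a + 1)) with h | h
      · exact ⟨a + 1, t, 0, 0, by omega, by omega, by omega, by omega, by omega, h1, h⟩
      · have := (binDigitSum_le_maxTerms a).2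
        exact ⟨a, t - 2, 1, 1, by omega, by omega, by omega, by omega, by omega, by omega,
          by omega⟩

lemma ak_lt_two_pow_of_sum_eq {k t : ℕ} (hk : 0 < k) (E : Finset ℕ)
    (hE : E ⊆ Finset.range (k + t)) (hc : E.card = t)
    (hs : ∑ e ∈ E, (2 : ZMod k) ^ e = 2 ^ (k + t) - 1) : ak k < 2 ^ (k + t) := by
  set N := ∑ i ∈ Finset.range (k + t) \ E, 2 ^ i with hN
  have hcard : binDigitSum N = k := by
    rw [hN, binDigitSum_sum_two_pow, Finset.card_sdiff_of_subset hE, Finset.card_range, hc]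
    omega
  have hpos : 0 < N := by
    rcases Nat.eq_zero_or_pos N with h | h
    · rw [h] at hcard
      simp [binDigitSum] at hcard
      omega
    · exact h
  have hdvd : k ∣ N := by
    rw [← ZMod.natCast_eq_zero_iff]
    have h1 := Finset.sum_sdiff (f := fun i => (2 : ZMod k) ^ i) hE
    have h2 : ∑ i ∈ Finset.range (k + t), (2 : ZMod k) ^ i = 2 ^ (k + t) - 1 := by
      have := geom_sum_mul (2 : ZMod k) (k + t)
      rwa [show (2 : ZMod k) - 1 = 1 by ring, mul_one] at this
    rw [hs, h2] at h1
    rw [hN]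
    push_cast
    simpa using h1
  have hlt : N < 2 ^ (k + t) :=
    Nat.geomSum_lt le_rfl fun i hi => Finset.mem_range.1 (Finset.mem_sdiff.1 hi).1
  exact (Nat.sInf_le ⟨hpos, hdvd, hcard⟩ : ak k ≤ N).trans_lt hlt

lemma lt_of_sum_two_pow_lt {U : Finset ℕ} {L i : ℕ} (h : ∑ i ∈ U, 2 ^ i < 2 ^ L) (hi : i ∈ U) :
    i < L := by
  have h1 : 2 ^ i ≤ ∑ i ∈ U, 2 ^ i :=
    Finset.single_le_sum (f := fun i => 2 ^ i) (fun _ _ => Nat.zero_le _) hi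
  exact (Nat.pow_lt_pow_iff_right (by norm_num)).1 (h1.trans_lt h)

lemma ak_lt_two_pow_of_natCast_add_sum_eq {k t L P R : ℕ} (hk : 0 < k) (W : Finset ℕ)
    (hW : W ⊆ Finset.Ico L P) (hLP : L ≤ P) (hP : (2 : ZMod k) ^ P = 1) (hb : L + P ≤ k + t)
    (hR : R < 2 ^ L) (hR1 : binDigitSum R + W.card ≤ t) (hR2 : 2 ^ (t - W.card) ≤ R + 1)
    (hs : (R : ZMod k) + ∑ e ∈ W, (2 : ZMod k) ^ e = 2 ^ (k + t) - 1) :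
    ak k < 2 ^ (k + t) := by
  obtain ⟨U, V, hc, hUV⟩ := exists_sum_two_pow_add_sum_two_pow
    (show binDigitSum R ≤ t - W.card by omega) (le_maxTerms hR2)
  have hU : ∀ i ∈ U, i < L := fun i hi => lt_of_sum_two_pow_lt (by omega) hi
  have hV : ∀ i ∈ V, i < L := fun i hi => lt_of_sum_two_pow_lt (by omega) hi
  have hW' : ∀ i ∈ W, L ≤ i ∧ i < P := fun i hi => Finset.mem_Ico.1 (hW hi)
  have hinj : Function.Injective fun i : ℕ => i + P := fun a b h => by simpa using h
  have hd1 : Disjoint U W := Finset.disjoint_left.2 fun i hi hi' => by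
    have := hU i hi
    have := hW' i hi'
    omega
  have hd2 : Disjoint (U ∪ W) (V.image fun i => i + P) := Finset.disjoint_left.2 fun i hi hi' => by
    obtain ⟨j, -, rfl⟩ := Finset.mem_image.1 hi'
    rcases Finset.mem_union.1 hi with h | h
    · have := hU _ h
      omega
    · have := hW' _ h
      omega
  refine ak_lt_two_pow_of_sum_eq hk ((U ∪ W) ∪ V.image fun i => i + P) ?_ ?_ ?_
  · intro i hi
    rw [Finset.mem_union, Finset.mem_union, Finset.mem_image] at hi
    rw [Finset.mem_range]
    rcases hi with (h | h) | ⟨j, hj, rfl⟩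
    · have := hU _ h
      omega
    · have := hW' _ h
      omega
    · have := hV _ hj
      omega
  · rw [Finset.card_union_of_disjoint hd2, Finset.card_union_of_disjoint hd1,
      Finset.card_image_of_injective V hinj]
    omega
  · rw [Finset.sum_union hd2, Finset.sum_union hd1, Finset.sum_image fun a _ b _ h => hinj h, ← hs,
      ← hUV]
    simp only [pow_add, hP, mul_one]
    push_cast
    ring

lemma exists_natCast_zmod_eq {k : ℕ} (hk : 0 < k) (b : ℕ) (c : ZMod k) :
    ∃ R : ℕ, b ≤ R ∧ R < b + k ∧ (R : ZMod k) = c := by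
  have : NeZero k := ⟨hk.ne'⟩
  refine ⟨b + (c - b).val, by omega, ?_, ?_⟩
  · have := ZMod.val_lt (c - (b : ZMod k))
    omega
  · push_cast
    rw [ZMod.natCast_zmod_val]
    ring

lemma isUnit_two_of_odd {k : ℕ} (hk : Odd k) : IsUnit (2 : ZMod k) := by
  have := (ZMod.isUnit_iff_coprime 2 k).2 (Nat.coprime_two_left.2 hk)
  exact_mod_cast this

lemma orderOf_two_bounds {k : ℕ} (hk : Odd k) (hk1 : 1 < k) :
    0 < orderOf (2 : ZMod k) ∧ orderOf (2 : ZMod k) < k := by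
  obtain ⟨u, hu⟩ := isUnit_two_of_odd hk
  have : NeZero k := ⟨by omega⟩
  rw [← hu, orderOf_units]
  refine ⟨orderOf_pos u, ?_⟩
  calc orderOf u ≤ Fintype.card (ZMod k)ˣ := orderOf_le_card_univ
    _ = k.totient := ZMod.card_units_eq_totient k
    _ < k := Nat.totient_lt k hk1

lemma ak_lt_of_sixteen_le {k : ℕ} (hk : Odd k) (hk16 : 16 ≤ k) :
    ak k < 2 ^ (k + (Nat.log 2 k + 1)) := by
  obtain ⟨hd0, hdk⟩ := orderOf_two_bounds hk (by omega)
  set d := orderOf (2 : ZMod k) with hd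
  set l := Nat.log 2 k with hl
  have hlk : 2 ^ l ≤ k := Nat.pow_log_le_self 2 (by omega)
  have hkl : k < 2 ^ (l + 1) := Nat.lt_pow_succ_log_self (by norm_num) k
  have hl4 : 4 ≤ l := by
    by_contra h
    have : 2 ^ (l + 1) ≤ 2 ^ 4 := Nat.pow_le_pow_right (by norm_num) (by omega)
    omega
  have hgrow : ∀ m : ℕ, 4 ≤ m → 2 * (m + 2) ≤ 2 ^ m := by
    intro m hm
    induction m, hm using Nat.le_induction with
    | base => norm_num
    | succ m hm ih => rw [pow_succ]; omega
  have hl2 := hgrow l hl4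
  have hq : 1 ≤ (k - 1) / d := (Nat.one_le_div_iff hd0).2 (by omega)
  have hP1 : d * ((k - 1) / d) ≤ k - 1 := Nat.mul_div_le _ _
  have hP2 : k - 1 < d * ((k - 1) / d) + d := by
    have := Nat.div_add_mod (k - 1) d
    have := Nat.mod_lt (k - 1) hd0
    omega
  have hP3 : d ≤ d * ((k - 1) / d) := Nat.le_mul_of_pos_right d hq
  obtain ⟨R, hR1, hR2, hR⟩ := exists_natCast_zmod_eq (show 0 < k by omega) (2 ^ (l + 1) - 1)
    (2 ^ (k + (l + 1)) - 1)
  have h2 : 2 ^ (l + 2) = 2 * 2 ^ (l + 1) := by ring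
  refine ak_lt_two_pow_of_natCast_add_sum_eq (L := l + 2) (P := d * ((k - 1) / d)) (R := R)
    (by omega) ∅ (by simp) (by omega) ?_ (by omega) (by omega) ?_ ?_ (by simpa using hR)
  · rw [pow_mul, hd, pow_orderOf_eq_one, one_pow]
  · have := binDigitSum_lt_of_succ_lt_two_pow (n := R) (L := l + 2) (by omega)
    rw [Finset.card_empty]
    omega
  · rw [Finset.card_empty, Nat.sub_zero]
    omega

lemma ak_lt_of_lt_orderOf {k v : ℕ} (hk1 : 1 < k) (hv : v ≤ Nat.log 2 k + 1)
    (hd : Nat.log 2 k + 2 + (Nat.log 2 k + 3) ^ v < orderOf (2 : ZMod k))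
    (hdk : 2 * orderOf (2 : ZMod k) ≤ k + 1) :
    ak k < 2 ^ (k + (Nat.log 2 k + 1 - v + 1)) := by
  set d := orderOf (2 : ZMod k) with hd_def
  set l := Nat.log 2 k with hl
  have hkl : k < 2 ^ (l + 1) := Nat.lt_pow_succ_log_self (by norm_num) k
  set a := l + 1 - v with ha
  have hvd : v < (l + 3) ^ v := Nat.lt_pow_self (by omega)
  have ha1 : 2 ^ a ≤ 2 ^ (l + 1) := Nat.pow_le_pow_right (by norm_num) (by omega)
  have ha0 : 0 < 2 ^ a := by positivity
  have h2 : 2 ^ (l + 2) = 2 * 2 ^ (l + 1) := by ring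
  choose R hR1 hR2 hR using fun e : ℕ => exists_natCast_zmod_eq (show 0 < k by omega) (2 ^ a - 1)
    ((2 : ZMod k) ^ (k + (a + 1)) - 1 - 2 ^ e)
  have hRlt : ∀ e, R e < 2 ^ (l + 2) := fun e => by
    have := hR2 e
    omega
  obtain ⟨e, he, hRe⟩ : ∃ e ∈ Finset.Ico (l + 2) d, binDigitSum (R e) ≤ a := by
    by_contra! hcon
    have hcard := Finset.card_le_card_of_injOn R (s := Finset.Ico (l + 2) d)
      (t := (Finset.range (2 ^ (l + 2))).filter (fun R => l + 2 ≤ binDigitSum R + v))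
      (fun e he => by
        have := hcon e he
        simp only [Finset.coe_filter, Finset.mem_range, Set.mem_ofPred_eq]
        exact ⟨hRlt e, by omega⟩)
      (fun e he f hf hef => by
        have h3 := hR e
        rw [show R e = R f from hef, hR f] at h3
        have h4 : (2 : ZMod k) ^ e = 2 ^ f := (sub_right_injective h3).symm
        exact pow_injOn_Iio_orderOf (Set.mem_Iio.2 (Finset.mem_Ico.1 he).2)
          (Set.mem_Iio.2 (Finset.mem_Ico.1 hf).2) h4)
    have h5 := hcard.trans (card_filter_le_binDigitSum_add (l + 2) v)
    rw [Nat.card_Ico] at h5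
    have h6 : l + 2 + 1 = l + 3 := by ring
    rw [h6] at h5
    omega
  refine ak_lt_two_pow_of_natCast_add_sum_eq (L := l + 2) (P := d) (R := R e) (by omega) {e}
    (by simpa using he) (by omega) (pow_orderOf_eq_one _) (by omega) (hRlt e) ?_ ?_ ?_
  · rw [Finset.card_singleton]
    omega
  · rw [Finset.card_singleton, Nat.add_sub_cancel]
    have := hR1 e
    omega
  · rw [Finset.sum_singleton, hR e]
    ring

lemma ak_lt_of_add_two_le_two_mul_orderOf {k : ℕ} (hk : Odd k) (hk1 : 1 < k)
    (hdk : k + 2 ≤ 2 * orderOf (2 : ZMod k)) : ak k < 2 ^ (k + 2) := by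
  obtain ⟨hd0, hd1⟩ := orderOf_two_bounds hk hk1
  have : NeZero k := ⟨by omega⟩
  set d := orderOf (2 : ZMod k) with hd
  set r : ZMod k := 2 ^ (k + 2) - 1
  set H : Finset (ZMod k) := (Finset.range d).image fun i => 2 ^ i with hH
  have hHc : H.card = d := by
    rw [hH, Finset.card_image_of_injOn, Finset.card_range]
    intro a ha b hb hab
    exact pow_injOn_Iio_orderOf (by simpa using ha) (by simpa using hb) hab
  have hH' : (H.image fun h => r - h).card = d := by
    rw [Finset.card_image_of_injective H sub_right_injective, hHc]
  have h1 : 1 < (H ∩ H.image fun h => r - h).card := by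
    have h2 := Finset.card_union_add_card_inter H (H.image fun h => r - h)
    have h3 := Finset.card_le_univ (H ∪ H.image fun h => r - h)
    rw [ZMod.card] at h3
    omega
  obtain ⟨h, hh, h', hh', hne⟩ := Finset.one_lt_card.1 h1
  have key : ∃ x ∈ H, ∃ y ∈ H, x ≠ y ∧ x + y = r := by
    obtain ⟨hx, hh⟩ := Finset.mem_inter.1 hh
    obtain ⟨hx', hh'⟩ := Finset.mem_inter.1 hh'
    obtain ⟨y, hy, hxy⟩ := Finset.mem_image.1 hh
    obtain ⟨y', hy', hxy'⟩ := Finset.mem_image.1 hh'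
    by_cases hc : h = y
    · by_cases hc' : h' = y'
      · exfalso
        subst hc hc'
        apply hne
        apply (isUnit_two_of_odd hk).mul_left_cancel
        linear_combination hxy' - hxy
      · exact ⟨h', hx', y', hy', hc', by rw [← hxy']; ring⟩
    · exact ⟨h, hx, y, hy, hc, by rw [← hxy]; ring⟩
  obtain ⟨x, hx, y, hy, hxy, hr⟩ := key
  obtain ⟨e, he, rfl⟩ := Finset.mem_image.1 hx
  obtain ⟨f, hf, rfl⟩ := Finset.mem_image.1 hy
  rw [Finset.mem_range] at he hf
  have hef : e ≠ f := fun h => hxy (by rw [h])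
  refine ak_lt_two_pow_of_sum_eq (by omega) {e, f} ?_ (Finset.card_pair hef) ?_
  · intro i hi
    rw [Finset.mem_insert, Finset.mem_singleton] at hi
    rw [Finset.mem_range]
    omega
  · rw [Finset.sum_pair hef, hr]

open ArithmeticFunction in
/-- An integer `M` with `log M ≤ Z` has few divisors up to `n`, on a logarithmic scale. -/
lemma sum_log_filter_dvd_le {M Z : ℕ} (n : ℕ) (hM : M ≠ 0) (hZ : 0 < Z)
    (hMZ : Real.log M ≤ Z) :
    ∑ k ∈ (Finset.Icc 1 n).filter (fun k => k ∣ M), Real.log k ≤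
      n * ((1 + Real.log Z) ^ 2 + 1) := by
  have hZ1 : (1 : ℝ) ≤ Z := by exact_mod_cast hZ
  have hlogZ : 0 ≤ Real.log Z := Real.log_nonneg hZ1
  have hswap : ∑ k ∈ (Finset.Icc 1 n).filter (fun k => k ∣ M), Real.log k =
      ∑ q ∈ M.divisors, ∑ k ∈ (Finset.Icc 1 n).filter (fun k => k ∣ M),
        if q ∣ k then vonMangoldt q else 0 := by
    rw [Finset.sum_comm]
    refine Finset.sum_congr rfl fun k hk => ?_
    rw [Finset.mem_filter, Finset.mem_Icc] at hk
    rw [← vonMangoldt_sum, ← Finset.sum_filter]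
    refine Finset.sum_congr ?_ fun _ _ => rfl
    ext q
    simp only [Nat.mem_divisors, Finset.mem_filter]
    exact ⟨fun h => ⟨⟨h.1.trans hk.2, hM⟩, h.1⟩, fun h => ⟨h.2, by omega⟩⟩
  have hterm : ∀ q ∈ M.divisors, (∑ k ∈ (Finset.Icc 1 n).filter (fun k => k ∣ M),
      if q ∣ k then vonMangoldt q else 0) ≤
      n * ((if q ∈ Finset.Icc 1 Z then Real.log Z * (q : ℝ)⁻¹ else 0) + vonMangoldt q / Z) := by
    intro q hq
    have hq0 : 0 < q := Nat.pos_of_mem_divisors hq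
    have hq0' : (0 : ℝ) < q := by exact_mod_cast hq0
    have hΛ : 0 ≤ vonMangoldt q := vonMangoldt_nonneg
    have hc : ((((Finset.Icc 1 n).filter (fun k => k ∣ M)).filter (fun k => q ∣ k)).card : ℝ) ≤
        n / q := by
      have h1 : (((Finset.Icc 1 n).filter (fun k => k ∣ M)).filter (fun k => q ∣ k)).card ≤
          n / q := by
        rw [← Nat.Ioc_filter_dvd_card_eq_div]
        refine Finset.card_le_card fun k hk => ?_
        simp only [Finset.mem_filter, Finset.mem_Icc, Finset.mem_Ioc] at hk ⊢
        exact ⟨⟨by omega, by omega⟩, hk.2⟩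
      exact (Nat.cast_le.2 h1).trans Nat.cast_div_le
    rw [← Finset.sum_filter, Finset.sum_const, nsmul_eq_mul]
    refine (mul_le_mul_of_nonneg_right hc hΛ).trans ?_
    rw [div_mul_eq_mul_div, mul_div_assoc]
    refine mul_le_mul_of_nonneg_left ?_ (Nat.cast_nonneg n)
    have hZ0 : (0 : ℝ) < Z := by linarith
    by_cases h : q ≤ Z
    · rw [if_pos (Finset.mem_Icc.2 ⟨hq0, h⟩)]
      have h1 : vonMangoldt q ≤ Real.log Z :=
        vonMangoldt_le_log.trans (Real.log_le_log hq0' (by exact_mod_cast h))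
      have h2 : vonMangoldt q / q ≤ Real.log Z * (q : ℝ)⁻¹ := by
        rw [div_eq_mul_inv]
        exact mul_le_mul_of_nonneg_right h1 (by positivity)
      have h3 : 0 ≤ vonMangoldt q / Z := by positivity
      linarith
    · rw [if_neg (fun h' => h (Finset.mem_Icc.1 h').2), zero_add]
      exact div_le_div_of_nonneg_left hΛ hZ0 (by exact_mod_cast (not_le.1 h).le)
  rw [hswap]
  refine (Finset.sum_le_sum hterm).trans ?_
  rw [← Finset.mul_sum, Finset.sum_add_distrib, ← Finset.sum_div, vonMangoldt_sum,
    ← Finset.sum_filter]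
  refine mul_le_mul_of_nonneg_left (add_le_add ?_ ?_) (Nat.cast_nonneg n)
  · rw [← Finset.mul_sum]
    have h1 : ∑ q ∈ M.divisors.filter (fun q => q ∈ Finset.Icc 1 Z), (q : ℝ)⁻¹ ≤
        ∑ q ∈ Finset.Icc 1 Z, (q : ℝ)⁻¹ :=
      Finset.sum_le_sum_of_subset_of_nonneg (fun q hq => (Finset.mem_filter.1 hq).2)
        fun _ _ _ => by positivity
    have h2 : ∑ q ∈ Finset.Icc 1 Z, (q : ℝ)⁻¹ ≤ 1 + Real.log Z := by
      have := harmonic_le_one_add_log Z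
      rw [harmonic_eq_sum_Icc] at this
      push_cast at this
      exact this
    nlinarith
  · exact div_le_one_of_le₀ hMZ (by linarith)

lemma ratio_le {k t : ℕ} (h : ak k < 2 ^ (k + t)) :
    (ak k : ℝ) / k / 2 ^ k ≤ 2 ^ t / k := by
  have h1 : (ak k : ℝ) ≤ 2 ^ (k + t) := by exact_mod_cast h.le
  rw [div_right_comm]
  refine div_le_div_of_nonneg_right ?_ (Nat.cast_nonneg k)
  rw [div_le_iff₀ (by positivity), ← pow_add, add_comm]
  exact h1

lemma exists_ratio_bound : ∃ C : ℝ, 0 < C ∧ ∀ k : ℕ, Odd k → (ak k : ℝ) / k / 2 ^ k ≤ C := by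
  have hnn : ∀ k : ℕ, 0 ≤ (ak k : ℝ) / k / 2 ^ k := fun k => by positivity
  have hs : 0 ≤ ∑ k ∈ Finset.range 16, (ak k : ℝ) / k / 2 ^ k :=
    Finset.sum_nonneg fun k _ => hnn k
  refine ⟨2 + ∑ k ∈ Finset.range 16, (ak k : ℝ) / k / 2 ^ k, by linarith, fun k hk => ?_⟩
  rcases lt_or_ge k 16 with h | h
  · have := Finset.single_le_sum (f := fun k : ℕ => (ak k : ℝ) / k / 2 ^ k) (fun k _ => hnn k)
      (Finset.mem_range.2 h)
    linarith
  · have h1 := ratio_le (ak_lt_of_sixteen_le hk h)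
    have h2 : (2 : ℝ) ^ Nat.log 2 k ≤ k := by
      exact_mod_cast Nat.pow_log_le_self 2 (by omega)
    have h3 : (2 : ℝ) ^ (Nat.log 2 k + 1) / k ≤ 2 := by
      rw [div_le_iff₀ (by exact_mod_cast (by omega : 0 < k)), pow_succ]
      linarith
    linarith

lemma ratio_le_four_div {k v : ℕ} (hk : Odd k) (hk1 : 1 < k) (hv : 2 ^ v ≤ k)
    (hd : Nat.log 2 k + 2 + (Nat.log 2 k + 3) ^ v < orderOf (2 : ZMod k)) :
    (ak k : ℝ) / k / 2 ^ k ≤ 4 / 2 ^ v := by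
  have hk0 : (0 : ℝ) < k := by exact_mod_cast (by omega : 0 < k)
  have hvk : (2 : ℝ) ^ v ≤ k := by exact_mod_cast hv
  have hvl : v ≤ Nat.log 2 k := Nat.le_log_of_pow_le (by norm_num) hv
  rcases le_or_gt (2 * orderOf (2 : ZMod k)) (k + 1) with h | h
  · refine (ratio_le (ak_lt_of_lt_orderOf hk1 (by omega) hd h)).trans ?_
    have h2 : (2 : ℝ) ^ Nat.log 2 k ≤ k := by
      exact_mod_cast Nat.pow_log_le_self 2 (by omega)
    rw [div_le_div_iff₀ hk0 (by positivity), ← pow_add,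
      show Nat.log 2 k + 1 - v + 1 + v = Nat.log 2 k + 2 by omega, pow_add]
    linarith
  · refine (ratio_le (ak_lt_of_add_two_le_two_mul_orderOf hk hk1 h)).trans ?_
    rw [div_le_div_iff₀ hk0 (by positivity)]
    linarith

lemma prod_two_pow_sub_one_pos (Y : ℕ) : 0 < ∏ d ∈ Finset.Icc 1 Y, (2 ^ d - 1) :=
  Finset.prod_pos fun d hd => by
    have := Nat.one_lt_two_pow (n := d) (by have := (Finset.mem_Icc.1 hd).1; omega)
    omega

lemma log_prod_two_pow_sub_one_le (Y : ℕ) :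
    Real.log (∏ d ∈ Finset.Icc 1 Y, (2 ^ d - 1) : ℕ) ≤ (Y ^ 2 : ℕ) := by
  have h1 : ∏ d ∈ Finset.Icc 1 Y, (2 ^ d - 1) ≤ 2 ^ (Y ^ 2) := by
    calc ∏ d ∈ Finset.Icc 1 Y, (2 ^ d - 1) ≤ ∏ d ∈ Finset.Icc 1 Y, 2 ^ Y :=
          Finset.prod_le_prod' fun d hd => (Nat.sub_le _ _).trans
            (Nat.pow_le_pow_right (by norm_num) (Finset.mem_Icc.1 hd).2)
      _ = 2 ^ (Y ^ 2) := by
          rw [Finset.prod_const, Nat.card_Icc, Nat.add_sub_cancel, ← pow_mul, sq]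
  have h2 : Real.log (∏ d ∈ Finset.Icc 1 Y, (2 ^ d - 1) : ℕ) ≤ Real.log ((2 : ℝ) ^ (Y ^ 2)) :=
    Real.log_le_log (by exact_mod_cast prod_two_pow_sub_one_pos Y) (by exact_mod_cast h1)
  rw [Real.log_pow] at h2
  refine h2.trans (mul_le_of_le_one_right (Nat.cast_nonneg _) ?_)
  linarith [Real.log_two_lt_d9]

lemma dvd_prod_of_orderOf_le {k Y : ℕ} (hk : Odd k) (hk1 : 1 < k)
    (h : orderOf (2 : ZMod k) ≤ Y) : k ∣ ∏ d ∈ Finset.Icc 1 Y, (2 ^ d - 1) := by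
  refine dvd_trans ?_ (Finset.dvd_prod_of_mem _
    (Finset.mem_Icc.2 ⟨(orderOf_two_bounds hk hk1).1, h⟩))
  rw [← ZMod.natCast_eq_zero_iff, Nat.cast_sub Nat.one_le_two_pow]
  push_cast
  rw [pow_orderOf_eq_one, sub_self]

lemma exists_sum_ratio_le : ∃ C : ℝ, 0 < C ∧ ∀ n : ℕ, 1 ≤ n →
    ∑ k ∈ (Finset.Icc 1 n).filter (fun k => Odd k), (ak k : ℝ) / k / 2 ^ k ≤
      n * (C / √((Nat.log 2 n + 1 : ℕ) : ℝ)) := by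
  obtain ⟨C, hC, hCk⟩ := exists_ratio_bound
  refine ⟨C + C * (8 * (82 * 4096)) + 8, by positivity, fun n hn => ?_⟩
  set J := Nat.log 2 n + 1 with hJ
  set v := Nat.log 4 J with hv
  set Y := (J + 3) ^ (v + 1) with hY
  set M := ∏ d ∈ Finset.Icc 1 Y, (2 ^ d - 1) with hM
  have hn0 : (0 : ℝ) < n := by exact_mod_cast hn
  have hJ0 : (1 : ℝ) ≤ J := by exact_mod_cast (by omega : 1 ≤ J)
  have hJn : J ≤ n := by
    have h1 : Nat.log 2 n < 2 ^ Nat.log 2 n := Nat.lt_two_pow_self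
    have h2 := Nat.pow_log_le_self 2 (show n ≠ 0 by omega)
    omega
  have hv1 : 4 ^ v ≤ J := Nat.pow_log_le_self 4 (by omega)
  have hv2 : J < 4 ^ (v + 1) := Nat.lt_pow_succ_log_self (by norm_num) J
  have hfour : ∀ m : ℕ, 4 ^ m = (2 ^ m) ^ 2 := fun m => by
    rw [← pow_mul, mul_comm, pow_mul]; norm_num
  have hlogn : (J : ℝ) / 4 ≤ Real.log n ∨ n = 1 := by
    rcases Nat.lt_or_ge 1 n with h | h
    · left
      have h1 : (2 : ℝ) ^ Nat.log 2 n ≤ n := by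
        exact_mod_cast Nat.pow_log_le_self 2 (show n ≠ 0 by omega)
      have h2 := Real.log_le_log (by positivity) h1
      rw [Real.log_pow] at h2
      have h3 : 1 ≤ Nat.log 2 n := Nat.log_pos (by norm_num) h
      have h4 : (1 : ℝ) ≤ Nat.log 2 n := by exact_mod_cast h3
      have h5 := Real.log_two_gt_d9
      rw [hJ]
      push_cast
      nlinarith
    · right
      omega
  have hpoint : ∀ k ∈ (Finset.Icc 1 n).filter (fun k => Odd k), (ak k : ℝ) / k / 2 ^ k ≤
      (if k ≤ Nat.sqrt n then C else 0) + (if k ∣ M then C * (8 / J) * Real.log k else 0) +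
        8 / √(J : ℝ) := by
    intro k hk
    rw [Finset.mem_filter, Finset.mem_Icc] at hk
    obtain ⟨⟨hk0, hkn⟩, hodd⟩ := hk
    have hlogk : 0 ≤ Real.log k := Real.log_natCast_nonneg k
    have h8 : 0 ≤ 8 / √(J : ℝ) := by positivity
    have hmid : 0 ≤ C * (8 / J) * Real.log k := by positivity
    by_cases h1 : k ≤ Nat.sqrt n
    · rw [if_pos h1]
      have := hCk k hodd
      split_ifs <;> linarith
    · rw [if_neg h1]
      have hkk : n < k * k := Nat.sqrt_lt.1 (not_le.1 h1)
      have hk1 : 1 < k := by nlinarith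
      by_cases h2 : k ∣ M
      · rw [if_pos h2]
        have h3 : Real.log n ≤ 2 * Real.log k := by
          have h4 : Real.log n ≤ Real.log ((k : ℝ) ^ 2) :=
            Real.log_le_log hn0 (by rw [sq]; exact_mod_cast hkk.le)
          rw [Real.log_pow] at h4
          exact_mod_cast h4
        have h4 : (J : ℝ) ≤ 8 * Real.log k := by
          rcases hlogn with h | h
          · linarith
          · omega
        have h5 : C ≤ C * (8 / J) * Real.log k := by
          rw [show C * (8 / J) * Real.log k = C * (8 * Real.log k / J) by ring]
          exact le_mul_of_one_le_right hC.le ((one_le_div (by linarith)).2 h4)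
        have := hCk k hodd
        linarith
      · rw [if_neg h2, zero_add, zero_add]
        have hd : Y < orderOf (2 : ZMod k) := by
          by_contra h
          exact h2 (dvd_prod_of_orderOf_le hodd hk1 (not_lt.1 h))
        have hlk : Nat.log 2 k + 1 ≤ J := Nat.succ_le_succ (Nat.log_mono_right hkn)
        have hYk : Nat.log 2 k + 2 + (Nat.log 2 k + 3) ^ v ≤ Y := by
          have h3 : (Nat.log 2 k + 3) ^ v ≤ (J + 3) ^ v := Nat.pow_le_pow_left (by omega) v
          have h4 : 1 ≤ (J + 3) ^ v := Nat.one_le_pow _ _ (by omega)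
          rw [hY, pow_succ]
          nlinarith
        have h2v : 2 ^ v ≤ k := by
          have := hfour v
          refine (Nat.pow_le_pow_iff_left (n := 2) (by norm_num)).1 ?_
          rw [← hfour, sq]
          omega
        refine (ratio_le_four_div hodd hk1 h2v (hYk.trans_lt hd)).trans ?_
        rw [div_le_div_iff₀ (by positivity) (by positivity)]
        have h5 : √(J : ℝ) ≤ 2 ^ (v + 1) := by
          refine Real.sqrt_le_left (by positivity) |>.2 ?_
          have := hfour (v + 1)
          rw [this] at hv2
          exact_mod_cast hv2.le
        rw [pow_succ] at h5
        linarith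
  refine (Finset.sum_le_sum hpoint).trans ?_
  have hnonneg : ∀ k : ℕ, 0 ≤ (if k ≤ Nat.sqrt n then C else 0) +
      (if k ∣ M then C * (8 / J) * Real.log k else 0) + 8 / √(J : ℝ) := fun k => by
    have := Real.log_natCast_nonneg k
    refine add_nonneg (add_nonneg ?_ ?_) (by positivity) <;> split_ifs <;> positivity
  refine (Finset.sum_le_sum_of_subset_of_nonneg (Finset.filter_subset _ _)
    fun k _ _ => hnonneg k).trans ?_
  rw [Finset.sum_add_distrib, Finset.sum_add_distrib, ← Finset.sum_filter, ← Finset.sum_filter,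
    Finset.sum_const, Finset.sum_const, Nat.card_Icc, Nat.add_sub_cancel, nsmul_eq_mul,
    nsmul_eq_mul, ← Finset.mul_sum, add_div, add_div, mul_add, mul_add]
  refine add_le_add (add_le_add ?_ ?_) le_rfl
  · have h1 : ((Finset.Icc 1 n).filter (fun k => k ≤ Nat.sqrt n)).card ≤ Nat.sqrt n := by
      calc _ ≤ (Finset.Icc 1 (Nat.sqrt n)).card := Finset.card_le_card fun k hk => by
            simp only [Finset.mem_filter, Finset.mem_Icc] at hk ⊢
            omega
        _ = Nat.sqrt n := by simp
    have h2 : (Nat.sqrt n : ℝ) ≤ √(n : ℝ) := Real.nat_sqrt_le_real_sqrt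
    have h3 : √(n : ℝ) ≤ n / √(J : ℝ) := by
      rw [le_div_iff₀ (by positivity)]
      calc √(n : ℝ) * √(J : ℝ) ≤ √(n : ℝ) * √(n : ℝ) :=
            mul_le_mul_of_nonneg_left (Real.sqrt_le_sqrt (by exact_mod_cast hJn)) (by positivity)
        _ = n := Real.mul_self_sqrt hn0.le
    have h4 : (((Finset.Icc 1 n).filter (fun k => k ≤ Nat.sqrt n)).card : ℝ) ≤ n / √(J : ℝ) :=
      (Nat.cast_le.2 h1).trans (h2.trans h3)
    calc _ ≤ n / √(J : ℝ) * C := mul_le_mul_of_nonneg_right h4 hC.le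
      _ = n * (C / √(J : ℝ)) := by ring
  · have hYpos : 0 < Y := by positivity
    have h1 := sum_log_filter_dvd_le (M := M) (Z := Y ^ 2) n (prod_two_pow_sub_one_pos Y).ne'
      (by positivity) (log_prod_two_pow_sub_one_le Y)
    have h2 : (1 + Real.log (Y ^ 2 : ℕ)) ^ 2 + 1 ≤ 82 * 4096 * √(J : ℝ) := by
      obtain ⟨w, hw1, hw⟩ : ∃ w : ℝ, 1 ≤ w ∧ (J : ℝ) = w ^ 8 := by
        refine ⟨(J : ℝ) ^ ((1 : ℝ) / 8), Real.one_le_rpow hJ0 (by norm_num), ?_⟩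
        rw [← Real.rpow_natCast, ← Real.rpow_mul (by linarith)]
        norm_num
      have hsqrt : √(J : ℝ) = w ^ 4 := by
        rw [hw, show w ^ 8 = (w ^ 4) ^ 2 by ring, Real.sqrt_sq (by positivity)]
      have hlogJ : Real.log J ≤ 8 * w := by
        rw [hw, Real.log_pow]
        have := Real.log_le_self (show 0 ≤ w by linarith)
        push_cast
        linarith
      have hlog4 : 1 ≤ Real.log 4 ∧ Real.log 4 ≤ 2 := by
        rw [show (4 : ℝ) = 2 ^ 2 by norm_num, Real.log_pow]
        have := Real.log_two_gt_d9
        have := Real.log_two_lt_d9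
        push_cast
        constructor <;> linarith
      have hvJ : (v : ℝ) ≤ 8 * w := by
        have h3 : Real.log ((4 : ℝ) ^ v) ≤ Real.log J :=
          Real.log_le_log (by positivity) (by exact_mod_cast hv1)
        rw [Real.log_pow] at h3
        nlinarith [Nat.cast_nonneg (α := ℝ) v]
      have hJ3 : Real.log ((J : ℝ) + 3) ≤ 2 + 8 * w := by
        have h3 : Real.log ((J : ℝ) + 3) ≤ Real.log (4 * J) :=
          Real.log_le_log (by linarith) (by linarith)
        rw [Real.log_mul (by norm_num) (by linarith)] at h3
        linarith
      have hlogZ : Real.log (Y ^ 2 : ℕ) = 2 * ((v + 1) * Real.log ((J : ℝ) + 3)) := by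
        rw [hY]
        push_cast
        rw [Real.log_pow, Real.log_pow]
        push_cast
        ring
      have h0 : 0 ≤ Real.log ((J : ℝ) + 3) := Real.log_nonneg (by linarith)
      have h5 : Real.log (Y ^ 2 : ℕ) ≤ 2 * ((9 * w) * (10 * w)) := by
        rw [hlogZ]
        have := mul_le_mul (show (v : ℝ) + 1 ≤ 9 * w by linarith)
          (show Real.log ((J : ℝ) + 3) ≤ 10 * w by linarith) h0 (by positivity)
        linarith
      have h6 : 0 ≤ Real.log (Y ^ 2 : ℕ) := Real.log_natCast_nonneg _
      have hw2 : 1 ≤ w ^ 2 := one_le_pow₀ hw1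
      have h7 : 1 + Real.log (Y ^ 2 : ℕ) ≤ 181 * w ^ 2 := by nlinarith
      have h8 : (1 + Real.log (Y ^ 2 : ℕ)) ^ 2 ≤ (181 * w ^ 2) ^ 2 :=
        pow_le_pow_left₀ (by linarith) h7 2
      have hw4 : 1 ≤ w ^ 4 := one_le_pow₀ hw1
      rw [hsqrt]
      nlinarith
    have h3 : ∑ k ∈ (Finset.Icc 1 n).filter (fun k => k ∣ M), Real.log k ≤
        n * (82 * 4096 * √(J : ℝ)) := h1.trans (mul_le_mul_of_nonneg_left h2 hn0.le)
    calc _ ≤ C * (8 / J) * (n * (82 * 4096 * √(J : ℝ))) :=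
          mul_le_mul_of_nonneg_left h3 (by positivity)
      _ = n * (C * (8 * (82 * 4096)) * (√(J : ℝ) / J)) := by ring
      _ = n * (C * (8 * (82 * 4096)) / √(J : ℝ)) := by
          rw [Real.sqrt_div_self', mul_one_div]

lemma one_le_plog (x : ℝ) : 1 ≤ plog x := le_max_right _ _

lemma plog_le_self {x : ℝ} (hx : 1 ≤ x) : plog x ≤ x :=
  max_le (Real.log_le_self (by linarith)) hx

lemma plog_le_two_mul_sqrt {x : ℝ} (hx : 1 ≤ x) : plog x ≤ 2 * √x := by
  have h1 : 1 ≤ √x := Real.one_le_sqrt.2 hx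
  refine max_le ?_ (by linarith)
  have h2 := Real.log_le_self (Real.sqrt_nonneg x)
  rw [Real.log_sqrt (by linarith)] at h2
  linarith

lemma tendsto_plog : Tendsto plog atTop atTop :=
  tendsto_atTop_mono (fun _ => le_max_left _ _) Real.tendsto_log_atTop

lemma exists_average_le : ∃ C : ℝ, 0 < C ∧ ∀ x : ℝ, 1 ≤ x →
    (1 / x) * ∑ k ∈ (Finset.Icc 1 ⌊x⌋₊).filter (fun k => Odd k),
      (ak k : ℝ) / k / 2 ^ k ≤ C / plog (plog (plog x)) := by
  obtain ⟨C, hC, h⟩ := exists_sum_ratio_le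
  refine ⟨2 * C, by positivity, fun x hx => ?_⟩
  have hn : 1 ≤ ⌊x⌋₊ := Nat.one_le_floor_iff x |>.2 hx
  set J := Nat.log 2 ⌊x⌋₊ + 1 with hJ
  have hJ0 : (1 : ℝ) ≤ J := by exact_mod_cast (by omega : 1 ≤ J)
  have hxJ : x < 2 ^ J := by
    have h1 : ⌊x⌋₊ + 1 ≤ 2 ^ J := Nat.lt_pow_succ_log_self (by norm_num) _
    have h2 : ((⌊x⌋₊ + 1 : ℕ) : ℝ) ≤ (2 ^ J : ℕ) := Nat.cast_le.2 h1
    push_cast at h2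
    exact (Nat.lt_floor_add_one x).trans_le h2
  have hplog : plog x ≤ J := by
    refine max_le ?_ hJ0
    have h1 := Real.log_le_log (by linarith) hxJ.le
    rw [Real.log_pow] at h1
    have := Real.log_two_lt_d9
    nlinarith
  have h3 : plog (plog (plog x)) ≤ 2 * √(J : ℝ) :=
    (plog_le_self (one_le_plog _)).trans ((plog_le_two_mul_sqrt (one_le_plog x)).trans
      (mul_le_mul_of_nonneg_left (Real.sqrt_le_sqrt hplog) (by norm_num)))
  have hsq : 0 < √(J : ℝ) := Real.sqrt_pos.2 (by linarith)
  have hp0 : 0 < plog (plog (plog x)) := one_pos.trans_le (one_le_plog _)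
  have h4 : C / √(J : ℝ) ≤ 2 * C / plog (plog (plog x)) := by
    rw [div_le_div_iff₀ hsq hp0]
    nlinarith
  refine le_trans ?_ h4
  rw [one_div_mul_eq_div, div_le_iff₀ (by linarith), mul_comm]
  exact (h _ hn).trans (mul_le_mul_of_nonneg_right (Nat.floor_le (by linarith)) (by positivity))

/-- Corollary: `(1/x) Σ_{k ≤ x, k odd} c_k/2^k = O(1/ log log log x)`, where
`c_k = a_k / k`; in particular the ratios `c_k/2^k` over odd `k` tend to `0` in
arithmetic average. -/
theorem average_ck_over_2k_small :
    (∃ C : ℝ, 0 < C ∧ ∀ x : ℝ, 1 ≤ x →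
      (1 / x) * ∑ k ∈ (Finset.Icc 1 ⌊x⌋₊).filter (fun k => Odd k),
          (ak k : ℝ) / k / 2 ^ k ≤ C / plog (plog (plog x))) ∧
    Tendsto (fun x : ℝ =>
        (1 / x) * ∑ k ∈ (Finset.Icc 1 ⌊x⌋₊).filter (fun k => Odd k),
          (ak k : ℝ) / k / 2 ^ k) atTop (nhds 0) := by
  obtain ⟨C, hC, h⟩ := exists_average_le
  refine ⟨⟨C, hC, h⟩, ?_⟩
  have hlim : Tendsto (fun x : ℝ => C / plog (plog (plog x))) atTop (nhds 0) :=
    tendsto_const_nhds.div_atTop (tendsto_plog.comp (tendsto_plog.comp tendsto_plog))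
  refine tendsto_of_tendsto_of_tendsto_of_le_of_le' tendsto_const_nhds hlim ?_ ?_
  · filter_upwards [eventually_ge_atTop 1] with x hx
    positivity
  · filter_upwards [eventually_ge_atTop 1] with x hx
    exact h x hx
end

section
/- For every integer base q ≥ 2 there exists a constant c (depending only on q) such that for every positive integer k there exists a positive integer n ≤ exp(c·k) with s_q(kn) = k. Consequently, the minimal q-Niven number satisfies a_k ≤ exp(O(k)) uniformly in k. -/
/-- `digSum q n` is the sum of the digits of `n` written in base `q`. -/
def digSum (q n : ℕ) : ℕ := (Nat.digits q n).sum

/-- `akq q k` is the smallest positive multiple of `k` whose base-`q` digit sum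
equals `k` (the minimal `q`-Niven number with digit sum `k`). -/
noncomputable def akq (q k : ℕ) : ℕ :=
  sInf {N : ℕ | 0 < N ∧ k ∣ N ∧ digSum q N = k}

theorem digSum_add_mul {q : ℕ} (hq : 2 ≤ q) {x : ℕ} (hx : x < q) (y : ℕ) :
    digSum q (x + q * y) = x + digSum q y := by
  unfold digSum
  by_cases h : x = 0 ∧ y = 0
  · simp [h.1, h.2]
  · rw [Nat.digits_add q (by omega) x y hx (by omega)]
    simp

theorem digSum_sum_mul_pow {q : ℕ} (hq : 2 ≤ q) (n : ℕ) (c : ℕ → ℕ) (hc : ∀ i, c i < q) :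
    digSum q (∑ i ∈ Finset.range n, c i * q ^ i) = ∑ i ∈ Finset.range n, c i := by
  induction n generalizing c with
  | zero => simp [digSum]
  | succ n ih =>
    rw [Finset.sum_range_succ', Finset.sum_range_succ', ← ih (fun i => c (i + 1)) fun i => hc _,
      add_comm _ (c 0), ← digSum_add_mul hq (hc 0), add_comm _ (c 0 * q ^ 0), Finset.mul_sum]
    congr 2
    · simp
    · exact Finset.sum_congr rfl fun i _ => by ring

theorem sum_mul_pow_lt_pow {q : ℕ} (n : ℕ) (c : ℕ → ℕ) (hc : ∀ i, c i < q) :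
    ∑ i ∈ Finset.range n, c i * q ^ i < q ^ n := by
  induction n with
  | zero => simp
  | succ n ih =>
    rw [Finset.sum_range_succ]
    have h : (c n + 1) * q ^ n ≤ q * q ^ n := Nat.mul_le_mul_right _ (hc n)
    rw [pow_succ']
    linarith

theorem digSum_pow_mul {q : ℕ} (hq : 2 ≤ q) (a n : ℕ) : digSum q (q ^ a * n) = digSum q n := by
  induction a with
  | zero => simp
  | succ a ih =>
    have h := digSum_add_mul hq (by omega : 0 < q) (q ^ a * n)
    rw [zero_add, zero_add, ih] at h
    rw [pow_succ', mul_assoc, h]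

theorem sum_div_pow_mod_mul_pow (q n k : ℕ) :
    ∑ i ∈ Finset.range n, k / q ^ i % q * q ^ i = k % q ^ n := by
  induction n with
  | zero => simp [Nat.mod_one]
  | succ n ih => rw [Finset.sum_range_succ, ih, Nat.mod_pow_succ, mul_comm]

/-- The powers of `q` modulo `k` are eventually periodic, and a period can be chosen in
`(k, 2 * k]`. -/
theorem exists_pow_add_period (q : ℕ) {k : ℕ} (hk : 1 ≤ k) :
    ∃ a T : ℕ, a ≤ k ∧ k < T ∧ T ≤ 2 * k ∧ (q : ZMod k) ^ (a + T) = (q : ZMod k) ^ a := by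
  have : NeZero k := ⟨by omega⟩
  obtain ⟨x, y, hxy, h⟩ := Fintype.exists_ne_map_eq_of_card_lt
    (fun i : Fin (k + 1) => (q : ZMod k) ^ (i : ℕ)) (by simp [ZMod.card])
  wlog hlt : x < y generalizing x y
  · exact this y x hxy.symm h.symm (lt_of_le_of_ne (not_lt.mp hlt) hxy.symm)
  have hlt' : (x : ℕ) < y := hlt
  obtain ⟨t, ht⟩ : ∃ t, (y : ℕ) = x + t := ⟨y - x, by omega⟩
  have hy := y.isLt
  have hper : ∀ n, (q : ZMod k) ^ ((x : ℕ) + t * n) = (q : ZMod k) ^ (x : ℕ) := by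
    intro n
    induction n with
    | zero => simp
    | succ n ih =>
      have h' : (q : ZMod k) ^ (x : ℕ) = (q : ZMod k) ^ ((x : ℕ) + t) := by rw [← ht]; exact h
      rw [show (x : ℕ) + t * (n + 1) = (x + t * n) + t by ring, pow_add, ih, ← pow_add, ← h']
  refine ⟨x, t * (k / t + 1), by omega, ?_, ?_, hper _⟩
  · exact Nat.lt_mul_div_succ k (by omega)
  · have := Nat.mul_div_le k t
    rw [mul_add]
    omega

theorem ZMod.sum_range_cast {M : Type*} [AddCommMonoid M] (T : ℕ) [NeZero T] (g : ZMod T → M) :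
    ∑ i ∈ Finset.range T, g (i : ZMod T) = ∑ x, g x := by
  refine Finset.sum_nbij' (fun i => (i : ZMod T)) ZMod.val ?_ ?_ ?_ ?_ ?_
  · simp
  · simp [ZMod.val_lt]
  · intro i hi
    exact ZMod.val_cast_of_lt (Finset.mem_range.mp hi)
  · simp
  · simp

/-- If a predicate on `ZMod T` holds somewhere and fails somewhere, then it fails immediately
before a place where it holds. -/
theorem ZMod.exists_not_and_add_one {T : ℕ} [NeZero T] {P : ZMod T → Prop}
    (h₁ : ∃ j, P j) (h₂ : ∃ j, ¬ P j) : ∃ j, ¬ P j ∧ P (j + 1) := by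
  by_contra! h
  obtain ⟨a, ha⟩ := h₁
  obtain ⟨b, hb⟩ := h₂
  have key : ∀ n : ℕ, P (a - n) := by
    intro n
    induction n with
    | zero => simpa using ha
    | succ n ih =>
      by_contra hn
      exact h _ hn (by simpa [sub_add_eq_sub_sub] using ih)
  exact hb (by simpa using key (a - b).val)

/-- Splitting one occurrence of the weight `w (j + 1) = q * w j` into `q` occurrences of `w j`
raises the number of occurrences by `q - 1` and preserves the weighted sum. -/
theorem exists_split {q T : ℕ} [NeZero T] (hq : 2 ≤ q) {R : Type*} [CommRing R] {w : ZMod T → R}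
    (hw : ∀ j, w (j + 1) = q * w j) {m : ZMod T → ℕ} (hm : ∀ j, m j ≤ q)
    (hpos : 0 < ∑ j, m j) (hlt : ∑ j, m j < T) :
    ∃ m' : ZMod T → ℕ, (∀ j, m' j ≤ q) ∧ ∑ j, m' j = ∑ j, m j + (q - 1) ∧
      ∑ j, (m' j : R) * w j = ∑ j, (m j : R) * w j := by
  obtain ⟨j, hj0, hj1⟩ : ∃ j, ¬ 0 < m j ∧ 0 < m (j + 1) := by
    apply ZMod.exists_not_and_add_one (P := fun j => 0 < m j)
    · by_contra! h
      have : ∑ j, m j = 0 := Finset.sum_eq_zero fun j _ => by have := h j; omega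
      omega
    · by_contra! h
      have : ∑ _j : ZMod T, 1 ≤ ∑ j, m j := Finset.sum_le_sum fun j _ => h j
      simp [ZMod.card] at this
      omega
  have hne : j + 1 ≠ j := fun h => hj0 (h ▸ hj1)
  let m' : ZMod T → ℕ := fun i => if i = j then q else if i = j + 1 then m i - 1 else m i
  have key : ∀ i, m' i + (if i = j + 1 then 1 else 0) = m i + (if i = j then q else 0) := by
    intro i
    by_cases h1 : i = j
    · subst h1
      simp [m', hne.symm]
      omega
    · by_cases h2 : i = j + 1
      · subst h2
        simp [m', hne]
        omega
      · simp [m', h1, h2]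
  refine ⟨m', fun i => ?_, ?_, ?_⟩
  · have := hm i
    simp only [m']
    split_ifs <;> omega
  · have h := Finset.sum_congr (rfl : (Finset.univ : Finset (ZMod T)) = _) fun i _ => key i
    simp only [Finset.sum_add_distrib, Finset.sum_ite_eq', Finset.mem_univ, if_true] at h
    omega
  · have h : ∑ i, ((m' i + (if i = j + 1 then 1 else 0) : ℕ) : R) * w i
        = ∑ i, ((m i + (if i = j then q else 0) : ℕ) : R) * w i :=
      Finset.sum_congr rfl fun i _ => by rw [key]
    simp only [Nat.cast_add, Nat.cast_ite, Nat.cast_one, Nat.cast_zero, add_mul, ite_mul, one_mul,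
      zero_mul, Finset.sum_add_distrib, Finset.sum_ite_eq', Finset.mem_univ, if_true, hw] at h
    exact add_right_cancel h

/-- A vanishing weighted sum in which every weight occurs at most `q` times and there are
exactly `k` occurrences in total. -/
theorem exists_multiplicities {q k a T : ℕ} (hq : 2 ≤ q) (hk : 1 ≤ k) (hT : k < T)
    (hper : (q : ZMod k) ^ (a + T) = (q : ZMod k) ^ a) :
    ∃ m : ℕ → ℕ, (∀ i, m i ≤ q) ∧ ∑ i ∈ Finset.range T, m i = k ∧
      ∑ i ∈ Finset.range T, (m i : ZMod k) * (q : ZMod k) ^ (a + i) = 0 := by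
  have : NeZero T := ⟨by omega⟩
  let w : ZMod T → ZMod k := fun j => (q : ZMod k) ^ (a + j.val)
  have hw : ∀ j, w (j + 1) = q * w j := by
    intro j
    have : Fact (1 < T) := ⟨by omega⟩
    have hj := ZMod.val_lt j
    simp only [w]
    rw [ZMod.val_add, ZMod.val_one]
    rcases Nat.lt_or_ge (j.val + 1) T with h | h
    · rw [Nat.mod_eq_of_lt h, ← pow_succ', add_assoc]
    · have h' : j.val + 1 = T := by omega
      rw [h', Nat.mod_self, ← pow_succ', add_assoc, h', hper, add_zero]
  have hkT : k < q ^ T := hT.trans (Nat.lt_pow_self (by omega))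
  have hdig := sum_div_pow_mod_mul_pow q T k
  rw [Nat.mod_eq_of_lt hkT] at hdig
  have hmod : ∀ i, k / q ^ i % q < q := fun i => Nat.mod_lt _ (by omega)
  have hs0 : digSum q k = ∑ i ∈ Finset.range T, k / q ^ i % q := by
    conv_lhs => rw [← hdig]
    exact digSum_sum_mul_pow hq T _ hmod
  have hle : digSum q k ≤ k := Nat.digit_sum_le q k
  have hpos : 0 < digSum q k := by
    by_contra h
    have hz : ∀ i ∈ Finset.range T, k / q ^ i % q = 0 :=
      Finset.sum_eq_zero_iff.mp (by omega)
    rw [Finset.sum_eq_zero fun i hi => by rw [hz i hi, zero_mul]] at hdig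
    omega
  have main : ∀ n, digSum q k + n * (q - 1) ≤ k → ∃ m : ZMod T → ℕ, (∀ j, m j ≤ q) ∧
      ∑ j, m j = digSum q k + n * (q - 1) ∧ ∑ j, (m j : ZMod k) * w j = 0 := by
    intro n
    induction n with
    | zero =>
      intro _
      refine ⟨fun j => k / q ^ j.val % q, fun j => (hmod _).le, ?_, ?_⟩
      · rw [← ZMod.sum_range_cast T (fun j => k / q ^ j.val % q), hs0, zero_mul, add_zero]
        exact Finset.sum_congr rfl fun i hi => by
          rw [ZMod.val_cast_of_lt (Finset.mem_range.mp hi)]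
      · rw [← ZMod.sum_range_cast T (fun j => ((k / q ^ j.val % q : ℕ) : ZMod k) * w j)]
        calc _ = ((q ^ a * ∑ i ∈ Finset.range T, k / q ^ i % q * q ^ i : ℕ) : ZMod k) := by
              rw [Finset.mul_sum, Nat.cast_sum]
              refine Finset.sum_congr rfl fun i hi => ?_
              simp only [w]
              rw [ZMod.val_cast_of_lt (Finset.mem_range.mp hi)]
              push_cast
              ring
          _ = 0 := by rw [hdig]; simp
    | succ n ih =>
      intro hn
      rw [add_mul, one_mul, ← add_assoc] at hn
      obtain ⟨m, hm, hsum, hzero⟩ := ih (by omega)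
      obtain ⟨m', hm', hsum', hzero'⟩ := exists_split hq hw hm (by omega) (by omega)
      exact ⟨m', hm', by rw [hsum', hsum]; ring, by rw [hzero', hzero]⟩
  obtain ⟨n, hn⟩ : q - 1 ∣ k - digSum q k := by
    rcases Nat.lt_or_ge q 3 with h | h
    · rw [show q - 1 = 1 by omega]
      exact one_dvd _
    · have h1 : q % (q - 1) = 1 := by
        rw [Nat.mod_eq_sub_mod (by omega), show q - (q - 1) = 1 by omega]
        exact Nat.mod_eq_of_lt (by omega)
      exact (Nat.modEq_iff_dvd' hle).mp (Nat.modEq_digits_sum (q - 1) q h1 k).symm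
  rw [mul_comm] at hn
  obtain ⟨m, hm, hsum, hzero⟩ := main n (by omega)
  refine ⟨fun i => m i, fun i => hm _, ?_, ?_⟩
  · rw [ZMod.sum_range_cast T m, hsum]
    omega
  · rw [← hzero, ← ZMod.sum_range_cast T]
    refine Finset.sum_congr rfl fun i hi => ?_
    simp only [w]
    rw [ZMod.val_cast_of_lt (Finset.mem_range.mp hi)]

theorem exists_multiple_digSum_eq {q k : ℕ} (hq : 2 ≤ q) (hk : 1 ≤ k) :
    ∃ N : ℕ, k ∣ N ∧ digSum q N = k ∧ N ≤ q ^ (5 * k) := by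
  obtain ⟨a, T, ha, hkT, hT, hper⟩ := exists_pow_add_period q hk
  obtain ⟨m, hm, hsum, hzero⟩ := exists_multiplicities hq hk hkT hper
  let c : ℕ → ℕ := fun i => if i < T then min (m i) (q - 1) else m (i - T) - (q - 1)
  have hc : ∀ i, c i < q := by
    intro i
    have h := hm (i - T)
    simp only [c]
    split_ifs <;> omega
  have hlow : ∀ i ∈ Finset.range T, c i = min (m i) (q - 1) := fun i hi =>
    if_pos (Finset.mem_range.mp hi)
  have hhigh : ∀ i, c (T + i) = m i - (q - 1) := by simp [c]
  have hadd : ∀ i ∈ Finset.range T, c i + c (T + i) = m i := by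
    intro i hi
    rw [hlow i hi, hhigh]
    omega
  refine ⟨q ^ a * ∑ i ∈ Finset.range (T + T), c i * q ^ i, ?_, ?_, ?_⟩
  · rw [← ZMod.natCast_eq_zero_iff, ← hzero, Finset.sum_range_add, ← Finset.sum_add_distrib,
      Finset.mul_sum, Nat.cast_sum]
    refine Finset.sum_congr rfl fun i hi => ?_
    rw [← hadd i hi]
    push_cast
    have h : (q : ZMod k) ^ a * ((q : ZMod k) ^ T * (q : ZMod k) ^ i)
        = (q : ZMod k) ^ a * (q : ZMod k) ^ i := by
      rw [← mul_assoc, ← pow_add, hper]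
    rw [pow_add, pow_add]
    linear_combination (c (T + i) : ZMod k) * h
  · rw [digSum_pow_mul hq, digSum_sum_mul_pow hq _ _ hc, Finset.sum_range_add,
      ← Finset.sum_add_distrib, Finset.sum_congr rfl hadd, hsum]
  · calc _ ≤ q ^ a * q ^ (T + T) := Nat.mul_le_mul_left _ (sum_mul_pow_lt_pow _ _ hc).le
      _ = q ^ (a + (T + T)) := (pow_add _ _ _).symm
      _ ≤ q ^ (5 * k) := Nat.pow_le_pow_right (by omega) (by omega)

/-- Theorem 17 of the paper: for every base `q ≥ 2` there is a constant `c`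
(depending only on `q`) such that for every `k ≥ 1` there exists `n ≤ exp(c k)`
with `s_q(kn) = k`; consequently `a_k ≤ exp(O(k))` uniformly in `k`. -/
theorem exists_small_niven_multiple (q : ℕ) (hq : 2 ≤ q) :
    (∃ c : ℝ, ∀ k : ℕ, 1 ≤ k → ∃ n : ℕ, 0 < n ∧
        (n : ℝ) ≤ Real.exp (c * k) ∧ digSum q (k * n) = k) ∧
    (∃ c : ℝ, ∀ k : ℕ, 1 ≤ k → (akq q k : ℝ) ≤ Real.exp (c * k)) := by
  have hexp : ∀ k N : ℕ, N ≤ q ^ (5 * k) → (N : ℝ) ≤ Real.exp (5 * Real.log q * k) := by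
    intro k N hN
    have hq0 : (0 : ℝ) < q := by exact_mod_cast (by omega : 0 < q)
    have h : Real.exp (5 * Real.log q * k) = (q : ℝ) ^ (5 * k) := by
      rw [← Real.exp_log hq0, ← Real.exp_nat_mul, Real.log_exp]
      push_cast
      ring_nf
    rw [h]
    exact_mod_cast hN
  have hpos : ∀ k n : ℕ, 1 ≤ k → digSum q (k * n) = k → 0 < k * n := by
    intro k n hk h
    by_contra h0
    rw [Nat.eq_zero_of_not_pos h0] at h
    simp [digSum] at h
    omega
  refine ⟨⟨5 * Real.log q, fun k hk => ?_⟩, ⟨5 * Real.log q, fun k hk => ?_⟩⟩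
  · obtain ⟨_, ⟨n, rfl⟩, hN, hle⟩ := exists_multiple_digSum_eq hq hk
    exact ⟨n, Nat.pos_of_mul_pos_left (hpos k n hk hN),
      hexp k n ((Nat.le_mul_of_pos_left n hk).trans hle), hN⟩
  · obtain ⟨_, ⟨n, rfl⟩, hN, hle⟩ := exists_multiple_digSum_eq hq hk
    have hmin : akq q k ≤ k * n := Nat.sInf_le ⟨hpos k n hk hN, dvd_mul_right k n, hN⟩
    exact hexp k _ (hmin.trans hle)
end
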